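/- Let J be a B(H)-ideal and S ∈ J. If at least one of the inclusions ⟨S⟩_J ⊆ (S)_J^ℝ, (S)_J^ℝ ⊆ (S)_J, (S)_J ⊆ (S) is an equality, then all are equalities, i.e., ⟨S⟩_J = (S)_J^ℝ = (S)_J = (S), and (S) is J-soft. -/

import Mathlib

open scoped BigOperators
open TopologicalSpace

variable {H : Type*} [NormedAddCommGroup H] [InnerProductSpace ℂ H] [CompleteSpace H]

/-- `J` is a two-sided ideal of `B(H)`: an additive subgroup closed under left and
right multiplication by arbitrary bounded operators. -/
def IsBHIdeal (J : Set (H →L[ℂ] H)) : Prop :=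
  (0 : H →L[ℂ] H) ∈ J ∧
  (∀ x ∈ J, ∀ y ∈ J, x + y ∈ J) ∧
  (∀ x ∈ J, -x ∈ J) ∧
  ∀ (A : H →L[ℂ] H), ∀ x ∈ J, A * x ∈ J ∧ x * A ∈ J

/-- `I` is a `J`-ideal: an additive subgroup of `B(H)` contained in `J` and closed
under left and right multiplication by elements of `J`. -/
def IsSubideal (J I : Set (H →L[ℂ] H)) : Prop :=
  I ⊆ J ∧ (0 : H →L[ℂ] H) ∈ I ∧
  (∀ x ∈ I, ∀ y ∈ I, x + y ∈ I) ∧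
  (∀ x ∈ I, -x ∈ I) ∧
  ∀ A ∈ J, ∀ x ∈ I, A * x ∈ I ∧ x * A ∈ I

/-- A linear `J`-ideal: a `J`-ideal closed under multiplication by complex scalars. -/
def IsLinearSubideal (J I : Set (H →L[ℂ] H)) : Prop :=
  IsSubideal J I ∧ ∀ (c : ℂ), ∀ x ∈ I, c • x ∈ I

/-- A real linear `J`-ideal: a `J`-ideal closed under multiplication by real scalars. -/
def IsRealSubideal (J I : Set (H →L[ℂ] H)) : Prop :=
  IsSubideal J I ∧ ∀ (r : ℝ), ∀ x ∈ I, r • x ∈ I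

/-- `(𝒮)`: the smallest two-sided ideal of `B(H)` containing `𝒮`. -/
def genBH (𝒮 : Set (H →L[ℂ] H)) : Set (H →L[ℂ] H) :=
  ⋂₀ {I | IsBHIdeal I ∧ 𝒮 ⊆ I}

/-- `⟨𝒮⟩_J`: the smallest `J`-ideal containing `𝒮`. -/
def genSub (J 𝒮 : Set (H →L[ℂ] H)) : Set (H →L[ℂ] H) :=
  ⋂₀ {I | IsSubideal J I ∧ 𝒮 ⊆ I}

/-- `(𝒮)_J`: the smallest linear `J`-ideal containing `𝒮`. -/
def genLin (J 𝒮 : Set (H →L[ℂ] H)) : Set (H →L[ℂ] H) :=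
  ⋂₀ {I | IsLinearSubideal J I ∧ 𝒮 ⊆ I}

/-- `(𝒮)_J^ℝ`: the smallest real linear `J`-ideal containing `𝒮`. -/
def genReal (J 𝒮 : Set (H →L[ℂ] H)) : Set (H →L[ℂ] H) :=
  ⋂₀ {I | IsRealSubideal J I ∧ 𝒮 ⊆ I}

/-- `J(𝒮)`: all finite sums `Σ Aᵢ Xᵢ` with `Aᵢ ∈ J` and `Xᵢ ∈ (𝒮)`. -/
def JGen (J 𝒮 : Set (H →L[ℂ] H)) : Set (H →L[ℂ] H) :=
  {T | ∃ (n : ℕ) (A X : Fin n → (H →L[ℂ] H)),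
    (∀ i, A i ∈ J ∧ X i ∈ genBH 𝒮) ∧ T = ∑ i, A i * X i}

/-- `J(𝒮)J`: all finite sums `Σ Aᵢ Xᵢ Bᵢ` with `Aᵢ, Bᵢ ∈ J` and `Xᵢ ∈ (𝒮)`. -/
def JGenJ (J 𝒮 : Set (H →L[ℂ] H)) : Set (H →L[ℂ] H) :=
  {T | ∃ (n : ℕ) (A X B : Fin n → (H →L[ℂ] H)),
    (∀ i, A i ∈ J ∧ X i ∈ genBH 𝒮 ∧ B i ∈ J) ∧ T = ∑ i, A i * X i * B i}

/-- `JS + SJ + J(S)J = {AS + SB + Y : A, B ∈ J, Y ∈ J(S)J}`. -/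
def JSplus (J : Set (H →L[ℂ] H)) (S : H →L[ℂ] H) : Set (H →L[ℂ] H) :=
  {T | ∃ A ∈ J, ∃ B ∈ J, ∃ Y ∈ JGenJ J {S}, T = A * S + S * B + Y}

/-- `K(H)`: the compact operators on `H`. -/
def KH : Set (H →L[ℂ] H) := {T | IsCompactOperator ⇑T}

/-- `T` is a finite-rank operator: its range is finite-dimensional. -/
def IsFiniteRank (T : H →L[ℂ] H) : Prop :=
  FiniteDimensional ℂ (LinearMap.range (T : H →ₗ[ℂ] H))

set_option linter.unusedSectionVars false

/-- Douglas' factorization lemma, for a norm bound with constant one. -/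
theorem exists_mul_eq_of_norm_le {T R : H →L[ℂ] H} (h : ∀ x, ‖T x‖ ≤ ‖R x‖) :
    ∃ C : H →L[ℂ] H, T = C * R := by
  let K : Submodule ℂ H := (LinearMap.range (R : H →ₗ[ℂ] H)).topologicalClosure
  have : CompleteSpace K :=
    (Submodule.isClosed_topologicalClosure (LinearMap.range (R : H →ₗ[ℂ] H))).completeSpace_coe
  have hmem (x : H) : R x ∈ K := Submodule.le_topologicalClosure _ ⟨x, rfl⟩
  let e : H →ₗ[ℂ] K := (R : H →ₗ[ℂ] H).codRestrict K hmem
  have hdense : DenseRange e := by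
    rintro ⟨y, hy⟩
    have himage : Subtype.val '' Set.range e = LinearMap.range (R : H →ₗ[ℂ] H) := by
      rw [← Set.range_comp]
      rfl
    rw [closure_subtype, himage]
    exact hy
  let C₀ : K →L[ℂ] H := (T : H →ₗ[ℂ] H).extendOfNorm e
  refine ⟨C₀ ∘L K.orthogonalProjectionOnto, ContinuousLinearMap.ext fun x ↦ ?_⟩
  have hproj : K.orthogonalProjectionOnto (R x) = e x :=
    Submodule.orthogonalProjectionOnto_mem_subspace_eq_self (K := K) (e x)
  have hext : C₀ (e x) = T x :=
    LinearMap.extendOfNorm_eq hdense ⟨1, fun y ↦ by simpa [e] using h y⟩ x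
  simp [hproj, hext]

/-- Two-sided ideals of `B(H)` are self-adjoint. -/
theorem IsBHIdeal.star_mem {J : Set (H →L[ℂ] H)} (hJ : IsBHIdeal J) {T : H →L[ℂ] H}
    (hT : T ∈ J) : star T ∈ J := by
  have hnorm (x : H) : ‖CFC.abs T x‖ = ‖T x‖ := by
    have key : inner ℂ (CFC.abs T x) (CFC.abs T x) = inner ℂ (T x) (T x) := by
      have hsa : star (CFC.abs T) = CFC.abs T := (CFC.abs_nonneg T).star_eq
      rw [← ContinuousLinearMap.adjoint_inner_right, ← ContinuousLinearMap.adjoint_inner_right,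
        ← ContinuousLinearMap.star_eq_adjoint, ← ContinuousLinearMap.star_eq_adjoint, hsa,
        ← mul_apply_eq_comp, ← mul_apply_eq_comp, CFC.abs_mul_abs]
    rw [inner_self_eq_norm_sq_to_K, inner_self_eq_norm_sq_to_K] at key
    have key' : ‖CFC.abs T x‖ ^ 2 = ‖T x‖ ^ 2 := by exact_mod_cast key
    exact (sq_eq_sq₀ (norm_nonneg _) (norm_nonneg _)).1 key'
  obtain ⟨U, hU⟩ := exists_mul_eq_of_norm_le fun x ↦ (hnorm x).ge
  obtain ⟨V, hV⟩ := exists_mul_eq_of_norm_le fun x ↦ (hnorm x).le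
  have habs : CFC.abs T ∈ J := hV ▸ (hJ.2.2.2 V T hT).1
  have hstar : star T = CFC.abs T * star U := by
    conv_lhs => rw [hU]
    rw [star_mul, (CFC.abs_nonneg T).star_eq]
  exact hstar ▸ (hJ.2.2.2 _ _ habs).2

/-- The isometry carrying a Hilbert basis to a given orthonormal family. -/
theorem HilbertBasis.exists_isometry {ι : Type*} (b : HilbertBasis ι ℂ H) {v : ι → H}
    (hv : Orthonormal ℂ v) : ∃ V : H →L[ℂ] H, star V * V = 1 ∧ ∀ i, V (b i) = v i := by
  classical
  let W : H →ₗᵢ[ℂ] H := hv.orthogonalFamily.linearIsometry.comp b.repr.toLinearIsometry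
  refine ⟨W.toContinuousLinearMap, ?_, fun i ↦ ?_⟩
  · exact (ContinuousLinearMap.norm_map_iff_adjoint_comp_self _).1 W.norm_map
  · change hv.orthogonalFamily.linearIsometry (b.repr (b i)) = v i
    rw [b.repr_self, OrthogonalFamily.linearIsometry_apply_single]
    simp

theorem exists_orthogonal_isometries (hH : ¬ FiniteDimensional ℂ H) :
    ∃ V W : H →L[ℂ] H, star V * V = 1 ∧ star W * W = 1 ∧ star V * W = 0 := by
  obtain ⟨w, b, -⟩ := exists_hilbertBasis ℂ H
  have hw : Infinite w := by
    by_contra hfin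
    have : Finite w := not_infinite_iff_finite.1 hfin
    have := Fintype.ofFinite w
    exact hH b.toOrthonormalBasis.toBasis.finiteDimensional_of_finite
  obtain ⟨e⟩ : Nonempty (w ⊕ w ≃ w) := by
    rw [← Cardinal.eq, ← Cardinal.add_def]
    exact Cardinal.add_eq_self (Cardinal.aleph0_le_mk w)
  obtain ⟨V, hV, hVb⟩ := b.exists_isometry
    (b.orthonormal.comp (e ∘ Sum.inl) (e.injective.comp Sum.inl_injective))
  obtain ⟨W, hW, hWb⟩ := b.exists_isometry
    (b.orthonormal.comp (e ∘ Sum.inr) (e.injective.comp Sum.inr_injective))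
  refine ⟨V, W, hV, hW, ContinuousLinearMap.ext_on
    (Submodule.dense_iff_topologicalClosure_eq_top.2 b.dense_span) ?_⟩
  rintro _ ⟨j, rfl⟩
  apply b.repr.injective
  ext i
  rw [b.repr_apply_apply, mul_apply_eq_comp, ContinuousLinearMap.star_eq_adjoint,
    ContinuousLinearMap.adjoint_inner_right, hVb, hWb]
  simp only [zero_apply, map_zero]
  exact b.orthonormal.2 fun h ↦ by simpa using e.injective h

/-- On a finite-dimensional space `B(H)` is simple. -/
theorem IsBHIdeal.one_mem_of_ne_zero [FiniteDimensional ℂ H] {J : Set (H →L[ℂ] H)}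
    (hJ : IsBHIdeal J) {S : H →L[ℂ] H} (hS : S ∈ J) (h0 : S ≠ 0) : 1 ∈ J := by
  obtain ⟨v, hv⟩ : ∃ v, S v ≠ 0 := by
    by_contra! h
    exact h0 (ContinuousLinearMap.ext h)
  have hrank (x y : H) : InnerProductSpace.rankOne ℂ x y ∈ J := by
    have hne : inner ℂ (S v) (S v) ≠ 0 := inner_self_ne_zero.2 hv
    have : InnerProductSpace.rankOne ℂ x y =
        ((inner ℂ (S v) (S v))⁻¹ • InnerProductSpace.rankOne ℂ x (S v)) *
          (S * InnerProductSpace.rankOne ℂ v y) := by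
      ext z
      simp only [mul_apply_eq_comp, smul_apply, InnerProductSpace.rankOne_apply, map_smul,
        smul_smul]
      rw [mul_comm (inner ℂ y z), inv_mul_cancel₀ hne, one_mul]
    exact this ▸ (hJ.2.2.2 _ _ (hJ.2.2.2 _ _ hS).2).1
  have hsum := (stdOrthonormalBasis ℂ H).sum_rankOne_eq_id
  change _ = (1 : H →L[ℂ] H) at hsum
  rw [← hsum]
  exact Finset.sum_induction _ (· ∈ J) (fun a b ha hb ↦ hJ.2.1 a ha b hb) hJ.1
    fun i _ ↦ hrank _ _

/-- A two-sided ideal of `B(H)`, as a complex subspace. -/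
def IsBHIdeal.toSubmodule {J : Set (H →L[ℂ] H)} (hJ : IsBHIdeal J) :
    Submodule ℂ (H →L[ℂ] H) where
  carrier := J
  add_mem' ha hb := hJ.2.1 _ ha _ hb
  zero_mem' := hJ.1
  smul_mem' c x hx := by simpa using (hJ.2.2.2 (c • 1) x hx).1

theorem Submodule.isBHIdeal_mul {P Q : Submodule ℂ (H →L[ℂ] H)}
    (hP : IsBHIdeal (P : Set (H →L[ℂ] H))) (hQ : IsBHIdeal (Q : Set (H →L[ℂ] H))) :
    IsBHIdeal ((P * Q : Submodule ℂ (H →L[ℂ] H)) : Set (H →L[ℂ] H)) := by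
  refine ⟨zero_mem _, fun x hx y hy ↦ add_mem hx hy, fun x hx ↦ neg_mem hx,
    fun A x hx ↦ ⟨?_, ?_⟩⟩
  · refine Submodule.mul_induction_on (SetLike.mem_coe.1 hx) (fun p hp q hq ↦ ?_)
      fun y z hy hz ↦ ?_
    · rw [← mul_assoc]
      exact Submodule.mul_mem_mul (hP.2.2.2 A p hp).1 hq
    · rw [mul_add]
      exact add_mem hy hz
  · refine Submodule.mul_induction_on (SetLike.mem_coe.1 hx) (fun p hp q hq ↦ ?_)
      fun y z hy hz ↦ ?_
    · rw [mul_assoc]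
      exact Submodule.mul_mem_mul hp (hQ.2.2.2 A q hq).2
    · rw [add_mul]
      exact add_mem hy hz

theorem Submodule.mul_le_mul_swap_of_isBHIdeal {P Q : Submodule ℂ (H →L[ℂ] H)}
    (hP : IsBHIdeal (P : Set (H →L[ℂ] H))) (hQ : IsBHIdeal (Q : Set (H →L[ℂ] H))) :
    P * Q ≤ Q * P :=
  Submodule.mul_le.2 fun p hp q hq ↦ by
    have hmem : star q * star p ∈ Q * P :=
      Submodule.mul_mem_mul (hQ.star_mem hq) (hP.star_mem hp)
    simpa using (Submodule.isBHIdeal_mul hQ hP).star_mem hmem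

theorem isBHIdeal_genBH (𝒮 : Set (H →L[ℂ] H)) : IsBHIdeal (genBH 𝒮) :=
  ⟨fun _ hI ↦ hI.1.1, fun x hx y hy I hI ↦ hI.1.2.1 x (hx I hI) y (hy I hI),
    fun x hx I hI ↦ hI.1.2.2.1 x (hx I hI),
    fun A x hx ↦ ⟨fun I hI ↦ (hI.1.2.2.2 A x (hx I hI)).1,
      fun I hI ↦ (hI.1.2.2.2 A x (hx I hI)).2⟩⟩

theorem isSubideal_genSub {J 𝒮 : Set (H →L[ℂ] H)} (hJ : IsBHIdeal J) (h𝒮 : 𝒮 ⊆ J) :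
    IsSubideal J (genSub J 𝒮) :=
  ⟨fun _ hx ↦ hx J ⟨⟨subset_rfl, hJ.1, hJ.2.1, hJ.2.2.1, fun A _ y hy ↦ hJ.2.2.2 A y hy⟩, h𝒮⟩,
    fun _ hI ↦ hI.1.2.1, fun x hx y hy I hI ↦ hI.1.2.2.1 x (hx I hI) y (hy I hI),
    fun x hx I hI ↦ hI.1.2.2.2.1 x (hx I hI),
    fun A hA x hx ↦ ⟨fun I hI ↦ (hI.1.2.2.2.2 A hA x (hx I hI)).1,
      fun I hI ↦ (hI.1.2.2.2.2 A hA x (hx I hI)).2⟩⟩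

theorem genSub_subset_genReal (J 𝒮 : Set (H →L[ℂ] H)) : genSub J 𝒮 ⊆ genReal J 𝒮 :=
  fun _ hx I hI ↦ hx I ⟨hI.1.1, hI.2⟩

theorem genReal_subset_genLin (J 𝒮 : Set (H →L[ℂ] H)) : genReal J 𝒮 ⊆ genLin J 𝒮 :=
  fun _ hx I hI ↦ hx I ⟨⟨hI.1.1, fun r y hy ↦ by simpa using hI.1.2 (r : ℂ) y hy⟩, hI.2⟩

theorem genLin_subset_genBH {J 𝒮 : Set (H →L[ℂ] H)} (hJ : IsBHIdeal J) (h𝒮 : 𝒮 ⊆ J) :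
    genLin J 𝒮 ⊆ genBH 𝒮 := by
  have hI := isBHIdeal_genBH 𝒮
  refine fun x hx ↦ hx _ ⟨⟨⟨fun y hy ↦ hy J ⟨hJ, h𝒮⟩, hI.1, hI.2.1, hI.2.2.1,
    fun A _ y hy ↦ hI.2.2.2 A y hy⟩, fun c y hy ↦ ?_⟩, fun y hy I hI ↦ hI.2 hy⟩
  exact hI.toSubmodule.smul_mem c hy

theorem coe_mul_eq_JGen {J 𝒮 : Set (H →L[ℂ] H)} (hJ : IsBHIdeal J) :
    ((hJ.toSubmodule * (isBHIdeal_genBH 𝒮).toSubmodule : Submodule ℂ (H →L[ℂ] H)) :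
      Set (H →L[ℂ] H)) = JGen J 𝒮 := by
  refine Set.Subset.antisymm (fun T hT ↦ ?_) ?_
  · refine Submodule.mul_induction_on (SetLike.mem_coe.1 hT) (fun A hA X hX ↦ ?_) ?_
    · exact ⟨1, fun _ ↦ A, fun _ ↦ X, fun _ ↦ ⟨hA, hX⟩, by simp⟩
    · rintro _ _ ⟨m, A, X, hAX, rfl⟩ ⟨n, B, Y, hBY, rfl⟩
      refine ⟨m + n, Fin.append A B, Fin.append X Y, fun i ↦ ?_, by simp [Fin.sum_univ_add]⟩
      refine Fin.addCases (fun i ↦ ?_) (fun i ↦ ?_) i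
      · simpa using hAX i
      · simpa using hBY i
  · rintro _ ⟨n, A, X, hAX, rfl⟩
    exact Submodule.sum_mem _ fun i _ ↦ Submodule.mul_mem_mul (hAX i).1 (hAX i).2

/-- The subspace `JS + SJ + J(S)J`. -/
def IsBHIdeal.softPart {J : Set (H →L[ℂ] H)} (hJ : IsBHIdeal J) (S : H →L[ℂ] H) :
    Submodule ℂ (H →L[ℂ] H) :=
  hJ.toSubmodule * Submodule.span ℂ {S} ⊔ Submodule.span ℂ {S} * hJ.toSubmodule ⊔
    hJ.toSubmodule * (isBHIdeal_genBH {S}).toSubmodule * hJ.toSubmodule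

section softPart

variable {J : Set (H →L[ℂ] H)} (hJ : IsBHIdeal J) {S : H →L[ℂ] H}

theorem mem_genBH_self (S : H →L[ℂ] H) : S ∈ genBH {S} := fun _ hI ↦ hI.2 rfl

theorem span_le_genBH (S : H →L[ℂ] H) :
    Submodule.span ℂ {S} ≤ (isBHIdeal_genBH {S}).toSubmodule := by
  rw [Submodule.span_singleton_le_iff_mem]
  exact mem_genBH_self S

theorem toSubmodule_mul_self_le : hJ.toSubmodule * hJ.toSubmodule ≤ hJ.toSubmodule :=
  Submodule.mul_le.2 fun A _ B hB ↦ (hJ.2.2.2 A B hB).1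

theorem mul_self_mem_softPart {A : H →L[ℂ] H} (hA : A ∈ J) : A * S ∈ hJ.softPart S :=
  Submodule.mem_sup_left (Submodule.mem_sup_left
    (Submodule.mem_mul_span_singleton.2 ⟨A, hA, rfl⟩))

theorem self_mul_mem_softPart {B : H →L[ℂ] H} (hB : B ∈ J) : S * B ∈ hJ.softPart S :=
  Submodule.mem_sup_left (Submodule.mem_sup_right
    (Submodule.mem_span_singleton_mul.2 ⟨B, hB, rfl⟩))

theorem softPart_mul_le : hJ.softPart S * hJ.toSubmodule ≤ hJ.softPart S := by
  rw [IsBHIdeal.softPart, Submodule.sup_mul, Submodule.sup_mul]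
  refine sup_le (sup_le ?_ ?_) ?_
  · refine le_sup_of_le_right ?_
    gcongr
    exact span_le_genBH S
  · refine le_sup_of_le_left (le_sup_of_le_right ?_)
    rw [mul_assoc]
    gcongr
    exact toSubmodule_mul_self_le hJ
  · refine le_sup_of_le_right ?_
    rw [mul_assoc _ hJ.toSubmodule]
    gcongr
    exact toSubmodule_mul_self_le hJ

theorem mul_softPart_le : hJ.toSubmodule * hJ.softPart S ≤ hJ.softPart S := by
  rw [IsBHIdeal.softPart, Submodule.mul_sup, Submodule.mul_sup]
  refine sup_le (sup_le ?_ ?_) ?_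
  · refine le_sup_of_le_left (le_sup_of_le_left ?_)
    rw [← mul_assoc]
    gcongr
    exact toSubmodule_mul_self_le hJ
  · refine le_sup_of_le_right ?_
    rw [← mul_assoc]
    gcongr
    exact span_le_genBH S
  · refine le_sup_of_le_right ?_
    rw [← mul_assoc, ← mul_assoc]
    gcongr
    exact toSubmodule_mul_self_le hJ

theorem softPart_subset : (hJ.softPart S : Set (H →L[ℂ] H)) ⊆ J := by
  change hJ.softPart S ≤ hJ.toSubmodule
  refine sup_le (sup_le ?_ ?_) ?_ <;> refine Submodule.mul_le.2 fun A hA B hB ↦ ?_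
  · exact (hJ.2.2.2 B A hA).2
  · exact (hJ.2.2.2 A B hB).1
  · exact (hJ.2.2.2 A B hB).1

/-- Left multiplication by an operator `X` respects `JS + SJ + J(S)J` as soon as `XS` is a
scalar multiple of `S` modulo that subspace. -/
theorem mul_mem_softPart {X T : H →L[ℂ] H} {c : ℂ} (hX : X * S - c • S ∈ hJ.softPart S)
    (hT : T ∈ hJ.softPart S) : X * T ∈ hJ.softPart S := by
  obtain ⟨T₁, hT₁, Y, hY, rfl⟩ := Submodule.mem_sup.1 hT
  obtain ⟨T₂, hT₂, T₃, hT₃, rfl⟩ := Submodule.mem_sup.1 hT₁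
  obtain ⟨A, hA, rfl⟩ := Submodule.mem_mul_span_singleton.1 hT₂
  obtain ⟨B, hB, rfl⟩ := Submodule.mem_span_singleton_mul.1 hT₃
  rw [mul_add, mul_add]
  refine add_mem (add_mem ?_ ?_) ?_
  · rw [← mul_assoc]
    exact mul_self_mem_softPart hJ (hJ.2.2.2 X A hA).1
  · have hsplit : X * (S * B) = (X * S - c • S) * B + c • (S * B) := by
      rw [sub_mul, smul_mul_assoc, mul_assoc, sub_add_cancel]
    rw [hsplit]
    exact add_mem (softPart_mul_le hJ (Submodule.mul_mem_mul hX hB))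
      (Submodule.smul_mem _ _ (self_mul_mem_softPart hJ hB))
  · exact Submodule.mem_sup_right ((Submodule.isBHIdeal_mul
      (Submodule.isBHIdeal_mul hJ (isBHIdeal_genBH {S})) hJ).2.2.2 X Y hY).1

theorem mul_mul_sub_smul_mem_softPart {X Y : H →L[ℂ] H} {c d : ℂ}
    (hX : X * S - c • S ∈ hJ.softPart S) (hY : Y * S - d • S ∈ hJ.softPart S) :
    X * Y * S - (c * d) • S ∈ hJ.softPart S := by
  have hsplit : X * Y * S - (c * d) • S = X * (Y * S - d • S) + d • (X * S - c • S) := by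
    rw [mul_sub, mul_smul_comm, smul_sub, smul_smul, mul_assoc, mul_comm c d]
    abel
  rw [hsplit]
  exact add_mem (mul_mem_softPart hJ hX hY) (Submodule.smul_mem _ _ hX)

theorem mem_softPart_of_sub_smul_mem {a : ℂ} (ha : a ≠ 0) (h : a • S ∈ hJ.softPart S) :
    S ∈ hJ.softPart S :=
  (Submodule.smul_mem_iff _ ha).1 h

/-- `RS + JS + SJ + J(S)J` is a `J`-ideal for every additive group `R` of scalars. -/
theorem isSubideal_scalars_softPart (hS : S ∈ J) (R : AddSubgroup ℂ) :
    IsSubideal J {T | ∃ c ∈ R, T - c • S ∈ hJ.softPart S} := by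
  refine ⟨?_, ⟨0, R.zero_mem, by simp⟩, ?_, ?_, ?_⟩
  · rintro T ⟨c, -, hc⟩
    have hsum := hJ.2.1 _ (softPart_subset hJ hc) _ (hJ.toSubmodule.smul_mem c hS)
    rwa [sub_add_cancel] at hsum
  · rintro T ⟨c, hcR, hc⟩ U ⟨d, hdR, hd⟩
    refine ⟨c + d, R.add_mem hcR hdR, ?_⟩
    rw [add_smul, add_sub_add_comm]
    exact add_mem hc hd
  · rintro T ⟨c, hcR, hc⟩
    refine ⟨-c, R.neg_mem hcR, ?_⟩
    rw [neg_smul, ← neg_sub']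
    exact neg_mem hc
  · rintro A hA T ⟨c, hcR, hc⟩
    refine ⟨⟨0, R.zero_mem, ?_⟩, ⟨0, R.zero_mem, ?_⟩⟩
    · have hsplit : A * T - (0 : ℂ) • S = A * (T - c • S) + c • (A * S) := by
        simp [mul_sub]
      rw [hsplit]
      exact add_mem (mul_softPart_le hJ (Submodule.mul_mem_mul hA hc))
        (Submodule.smul_mem _ _ (mul_self_mem_softPart hJ hA))
    · have hsplit : T * A - (0 : ℂ) • S = (T - c • S) * A + c • (S * A) := by
        simp [sub_mul]
      rw [hsplit]
      exact add_mem (softPart_mul_le hJ (Submodule.mul_mem_mul hc hA))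
        (Submodule.smul_mem _ _ (self_mul_mem_softPart hJ hA))

theorem mem_softPart_of_genSub_eq_genReal (hS : S ∈ J) (h : genSub J {S} = genReal J {S}) :
    S ∈ hJ.softPart S := by
  have hhalf : (1 / 2 : ℝ) • S ∈ genSub J {S} := h ▸ fun I hI ↦ hI.1.2 _ S (hI.2 rfl)
  obtain ⟨_, ⟨n, rfl⟩, hn⟩ := hhalf _
    ⟨isSubideal_scalars_softPart hJ hS (Int.castAddHom ℂ).range,
      Set.singleton_subset_iff.2 ⟨1, ⟨1, by simp⟩, by simp⟩⟩
  refine mem_softPart_of_sub_smul_mem hJ (a := 1 / 2 - n) ?_ ?_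
  · intro h0
    have h2 : (1 : ℂ) = ((2 * n : ℤ) : ℂ) := by
      push_cast
      linear_combination 2 * h0
    have : (1 : ℤ) = 2 * n := by exact_mod_cast h2
    omega
  · rw [sub_smul]
    convert hn using 2
    · rw [← Complex.coe_smul]
      push_cast
      rfl
    · rfl

theorem mem_softPart_of_genReal_eq_genLin (hS : S ∈ J) (h : genReal J {S} = genLin J {S}) :
    S ∈ hJ.softPart S := by
  have hI : Complex.I • S ∈ genReal J {S} := h ▸ fun I hI ↦ hI.1.2 _ S (hI.2 rfl)
  have hreal : IsRealSubideal J
      {T | ∃ c ∈ Complex.ofRealHom.toAddMonoidHom.range, T - c • S ∈ hJ.softPart S} := by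
    refine ⟨isSubideal_scalars_softPart hJ hS _, ?_⟩
    rintro s T ⟨_, ⟨r, rfl⟩, hr⟩
    refine ⟨_, ⟨s * r, rfl⟩, ?_⟩
    convert Submodule.smul_mem _ (s : ℂ) hr using 1
    simp only [smul_sub, smul_smul, Complex.coe_smul]
    congr 2
    exact Complex.ofReal_mul s r
  obtain ⟨_, ⟨r, rfl⟩, hr⟩ := hI _
    ⟨hreal, Set.singleton_subset_iff.2 ⟨1, ⟨1, by simp⟩, by simp⟩⟩
  refine mem_softPart_of_sub_smul_mem hJ (a := Complex.I - r) ?_ ?_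
  · intro h0
    simpa using congrArg Complex.im h0
  · rw [sub_smul]
    exact hr

theorem mem_softPart_of_genLin_eq_genBH (hS : S ∈ J) (h : genLin J {S} = genBH {S}) :
    S ∈ hJ.softPart S := by
  by_cases hfin : FiniteDimensional ℂ H
  · by_cases h0 : S = 0
    · simp [h0]
    · simpa using mul_self_mem_softPart hJ (S := S) (hJ.one_mem_of_ne_zero hS h0)
  · have hscalar (X : H →L[ℂ] H) : ∃ c : ℂ, X * S - c • S ∈ hJ.softPart S := by
      have hX : X * S ∈ genLin J {S} :=
        h ▸ ((isBHIdeal_genBH {S}).2.2.2 X S (mem_genBH_self S)).1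
      have hlin : IsLinearSubideal J
          {T | ∃ c ∈ (⊤ : AddSubgroup ℂ), T - c • S ∈ hJ.softPart S} := by
        refine ⟨isSubideal_scalars_softPart hJ hS ⊤, ?_⟩
        rintro s T ⟨r, -, hr⟩
        refine ⟨s * r, AddSubgroup.mem_top _, ?_⟩
        convert Submodule.smul_mem _ s hr using 1
        simp [smul_sub, smul_smul]
      obtain ⟨c, -, hc⟩ := hX _
        ⟨hlin, Set.singleton_subset_iff.2 ⟨1, AddSubgroup.mem_top _, by simp⟩⟩
      exact ⟨c, hc⟩
    obtain ⟨V, W, hV, hW, hVW⟩ := exists_orthogonal_isometries hfin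
    choose c hc using hscalar
    by_contra hne
    have hval {X : H →L[ℂ] H} {a b : ℂ} (hX : X = a • 1)
        (hb : X * S - b • S ∈ hJ.softPart S) : a = b := by
      by_contra hab
      refine hne (mem_softPart_of_sub_smul_mem hJ (sub_ne_zero.2 hab) ?_)
      rw [sub_smul]
      simpa [hX] using hb
    have hone : 1 = c (star V) * c V := hval (X := star V * V) (by simp [hV])
      (mul_mul_sub_smul_mem_softPart hJ (hc _) (hc _))
    have hone' : 1 = c (star W) * c W := hval (X := star W * W) (by simp [hW])
      (mul_mul_sub_smul_mem_softPart hJ (hc _) (hc _))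
    have hzero : 0 = c (star V) * c W := hval (X := star V * W) (by simp [hVW])
      (mul_mul_sub_smul_mem_softPart hJ (hc _) (hc _))
    rcases mul_eq_zero.1 hzero.symm with h0 | h0
    · simp [h0] at hone
    · simp [h0] at hone'

theorem mul_genBH_mul_subset_genSub (hS : S ∈ J) {T : H →L[ℂ] H}
    (hT : T ∈ hJ.toSubmodule * (isBHIdeal_genBH {S}).toSubmodule * hJ.toSubmodule) :
    T ∈ genSub J {S} := by
  have hG := isSubideal_genSub hJ (Set.singleton_subset_iff.2 hS)
  have hmem {X : H →L[ℂ] H} (hX : X ∈ genBH {S}) :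
      ∀ A ∈ J, ∀ B ∈ J, A * X * B ∈ genSub J {S} := by
    refine hX {X | ∀ A ∈ J, ∀ B ∈ J, A * X * B ∈ genSub J {S}} ⟨⟨?_, ?_, ?_, ?_⟩, ?_⟩
    · intro A _ B _
      simpa using hG.2.1
    · intro X hX Y hY A hA B hB
      simpa [mul_add, add_mul] using hG.2.2.1 _ (hX A hA B hB) _ (hY A hA B hB)
    · intro X hX A hA B hB
      simpa using hG.2.2.2.1 _ (hX A hA B hB)
    · refine fun C X hX ↦ ⟨fun A hA B hB ↦ ?_, fun A hA B hB ↦ ?_⟩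
      · simpa [mul_assoc] using hX _ (hJ.2.2.2 C A hA).2 B hB
      · simpa [mul_assoc] using hX A hA _ (hJ.2.2.2 C B hB).1
    · rintro _ rfl A hA B hB
      exact (hG.2.2.2.2 B hB _ (hG.2.2.2.2 A hA _ fun I hI ↦ hI.2 rfl).1).2
  refine Submodule.mul_induction_on hT (fun M hM B hB ↦ ?_) fun X Y hX hY ↦ hG.2.2.1 X hX Y hY
  refine Submodule.mul_induction_on hM (fun A hA X hX ↦ hmem hX A hA B hB) fun X Y hX hY ↦ ?_
  rw [add_mul]
  exact hG.2.2.1 _ hX _ hY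

theorem genBH_eq_mul_of_mem_softPart (h : S ∈ hJ.softPart S) :
    (isBHIdeal_genBH {S}).toSubmodule = hJ.toSubmodule * (isBHIdeal_genBH {S}).toSubmodule := by
  have hI := isBHIdeal_genBH {S}
  have hIJ : hI.toSubmodule * hJ.toSubmodule ≤ hJ.toSubmodule * hI.toSubmodule :=
    Submodule.mul_le_mul_swap_of_isBHIdeal hI hJ
  have hle : hJ.softPart S ≤ hJ.toSubmodule * hI.toSubmodule := by
    refine sup_le (sup_le ?_ ?_) ?_
    · gcongr
      exact span_le_genBH S
    · refine le_trans ?_ hIJ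
      gcongr
      exact span_le_genBH S
    · rw [mul_assoc]
      gcongr
      exact Submodule.mul_le.2 fun X hX A _ ↦ (hI.2.2.2 A X hX).2
  refine le_antisymm (fun T hT ↦ ?_) (Submodule.mul_le.2 fun A _ X hX ↦ (hI.2.2.2 A X hX).1)
  exact hT _ ⟨Submodule.isBHIdeal_mul hJ hI, Set.singleton_subset_iff.2 (hle h)⟩

theorem genBH_subset_genSub_of_mem_softPart (hS : S ∈ J) (h : S ∈ hJ.softPart S) :
    genBH {S} ⊆ genSub J {S} := by
  intro T hT
  apply mul_genBH_mul_subset_genSub hJ hS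
  have hI := isBHIdeal_genBH {S}
  have heq := genBH_eq_mul_of_mem_softPart hJ h
  have hle : hI.toSubmodule ≤ hJ.toSubmodule * hI.toSubmodule * hJ.toSubmodule := by
    rw [mul_assoc]
    refine heq.le.trans ?_
    gcongr
    exact heq.le.trans (Submodule.mul_le_mul_swap_of_isBHIdeal hJ hI)
  exact hle hT

end softPart

/-- equality of one inclusion in `⟨S⟩_J ⊆ (S)_J^ℝ ⊆ (S)_J ⊆ (S)`
implies equality throughout, and `(S)` is `J`-soft. -/
theorem stmt_6 (J : Set (H →L[ℂ] H)) (hJ : IsBHIdeal J)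
    (S : H →L[ℂ] H) (hS : S ∈ J)
    (h : genSub J {S} = genReal J {S} ∨ genReal J {S} = genLin J {S} ∨
         genLin J {S} = genBH {S}) :
    genSub J {S} = genBH {S} ∧ genReal J {S} = genBH {S} ∧
    genLin J {S} = genBH {S} ∧ genBH {S} = JGen J {S} := by
  have hmem : S ∈ hJ.softPart S := by
    rcases h with h | h | h
    · exact mem_softPart_of_genSub_eq_genReal hJ hS h
    · exact mem_softPart_of_genReal_eq_genLin hJ hS h
    · exact mem_softPart_of_genLin_eq_genBH hJ hS h
  have hle := genBH_subset_genSub_of_mem_softPart hJ hS hmem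
  have h₁ := genSub_subset_genReal J {S}
  have h₂ := genReal_subset_genLin J {S}
  have h₃ := genLin_subset_genBH hJ (Set.singleton_subset_iff.2 hS)
  refine ⟨(h₁.trans (h₂.trans h₃)).antisymm hle, (h₂.trans h₃).antisymm (hle.trans h₁),
    h₃.antisymm (hle.trans (h₁.trans h₂)), ?_⟩
  rw [← coe_mul_eq_JGen hJ, ← genBH_eq_mul_of_mem_softPart hJ hmem]
  rfl
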